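/- arXiv:1911.08362 — 2 statements merged into one kernel-verified Lean document; each statement's English description precedes it below -/
import Mathlib

section
/- Suppose V̂ satisfies the Bellman equation for π. Let 0 ≤ t' ≤ t'' ≤ N−1, let b' be any real-valued function of the partial trajectory τ_{0:t'} = (S_0, A_0, S_1, …, S_{t'}), and let b'' be any real-valued function of the partial trajectory τ_{0:t''} = (S_0, A_0, S_1, …, S_{t''}). Then cov_π(b'(τ_{0:t'}), b''(τ_{0:t''})·δ_{t''} | S_0 = s) = 0. -/
open Finset

attribute [local instance] Classical.propDecidable

namespace HCA

/-- A trajectory of horizon `N`: the actions taken at steps `0, …, N-1` and the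
states reached after each step (the start state is fixed separately). -/
abbrev Traj (S A : Type*) (N : ℕ) : Type _ := (Fin N → A) × (Fin N → S)

variable {S A : Type*} [Fintype S] [Fintype A] [Nonempty S] [Nonempty A]

/-- The state `S_k` of a trajectory with start state `s`. -/
def st {N : ℕ} (s : S) (τ : Traj S A N) : ℕ → S
  | 0 => s
  | k + 1 => if h : k < N then τ.2 ⟨k, h⟩ else s

/-- The action `A_k` of a trajectory. -/
noncomputable def ac {N : ℕ} (τ : Traj S A N) (k : ℕ) : A :=
  if h : k < N then τ.1 ⟨k, h⟩ else Classical.arbitrary A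

/-- The probability `P_π(τ) = ∏_{k=0}^{N-1} π(A_k|S_k)·P(S_{k+1}|S_k,A_k)` of a
trajectory starting at `s`. -/
noncomputable def trajP (π : S → A → ℝ) (P : S → A → S → ℝ) (s : S) (N : ℕ)
    (τ : Traj S A N) : ℝ :=
  ∏ k : Fin N, π (st s τ k) (τ.1 k) * P (st s τ k) (τ.1 k) (st s τ (k + 1))

/-- Expectation `E_π[f | S_0 = s]` over trajectories. -/
noncomputable def expct (π : S → A → ℝ) (P : S → A → S → ℝ) (s : S) (N : ℕ)
    (f : Traj S A N → ℝ) : ℝ :=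
  ∑ τ : Traj S A N, trajP π P s N τ * f τ

/-- Variance `Var_π(f | S_0 = s)` over trajectories. -/
noncomputable def vr (π : S → A → ℝ) (P : S → A → S → ℝ) (s : S) (N : ℕ)
    (f : Traj S A N → ℝ) : ℝ :=
  expct π P s N (fun τ => (f τ - expct π P s N f) ^ 2)

/-- Covariance `cov_π(f, g | S_0 = s)` over trajectories. -/
noncomputable def cv (π : S → A → ℝ) (P : S → A → S → ℝ) (s : S) (N : ℕ)
    (f g : Traj S A N → ℝ) : ℝ :=
  expct π P s N (fun τ => (f τ - expct π P s N f) * (g τ - expct π P s N g))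

/-- Probability `P_π(E | S_0 = s)` of an event `E` on trajectories. -/
noncomputable def prE (π : S → A → ℝ) (P : S → A → S → ℝ) (s : S) (N : ℕ)
    (E : Traj S A N → Prop) : ℝ :=
  ∑ τ : Traj S A N, if E τ then trajP π P s N τ else 0

/-- The TD error `δ_k = r(S_k,A_k) + γ·V̂(S_{k+1}) − V̂(S_k)`. -/
noncomputable def td (r : S → A → ℝ) (γ : ℝ) (V : S → ℝ) (s : S) {N : ℕ}
    (τ : Traj S A N) (k : ℕ) : ℝ :=
  r (st s τ k) (ac τ k) + γ * V (st s τ (k + 1)) - V (st s τ k)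

/-- `p_k(s'|s,a) = P_π(S_k = s' | S_0 = s, A_0 = a)
  = P_π(A_0 = a, S_k = s' | S_0 = s) / π(a|s)`. -/
noncomputable def pkSA (π : S → A → ℝ) (P : S → A → S → ℝ) (s : S) (N k : ℕ)
    (a : A) (s' : S) : ℝ :=
  prE π P s N (fun τ => ac τ 0 = a ∧ st s τ k = s') / π s a

/-- `p_k(s'|s) = Σ_a π(a|s)·p_k(s'|s,a)`. -/
noncomputable def pkS (π : S → A → ℝ) (P : S → A → S → ℝ) (s : S) (N k : ℕ)
    (s' : S) : ℝ :=
  ∑ a : A, π s a * pkSA π P s N k a s'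

/-- The hindsight probability `p_k(a|s,s')`, defined as
`P_π(A_0 = a, S_k = s' | S_0 = s)/p_k(s'|s)` when `p_k(s'|s) > 0` and `0` otherwise. -/
noncomputable def pkA (π : S → A → ℝ) (P : S → A → S → ℝ) (s : S) (N k : ℕ)
    (a : A) (s' : S) : ℝ :=
  if 0 < pkS π P s N k s' then
    prE π P s N (fun τ => ac τ 0 = a ∧ st s τ k = s') / pkS π P s N k s'
  else 0

/-- The `N`-step Monte-Carlo advantage estimator
`Â^MC_N(a) = (1(A_0=a)/π(a|s))·Σ_{k=0}^{N−1} γ^k·δ_k`. -/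
noncomputable def mcEst (π : S → A → ℝ) (r : S → A → ℝ) (γ : ℝ) (V : S → ℝ)
    (s : S) (N : ℕ) (a : A) (τ : Traj S A N) : ℝ :=
  ((if ac τ 0 = a then (1 : ℝ) else 0) / π s a) * ∑ k ∈ range N, γ ^ k * td r γ V s τ k

/-- The `N`-step δHCA advantage estimator
`Â^δHCA_N(a) = (1(A_0=a)/π(a|s))·δ_0 + Σ_{k=1}^{N−1} γ^k·(p_k(a|s,S_k)/π(a|s))·δ_k`. -/
noncomputable def dhcaEst (π : S → A → ℝ) (P : S → A → S → ℝ) (r : S → A → ℝ)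
    (γ : ℝ) (V : S → ℝ) (s : S) (N : ℕ) (a : A) (τ : Traj S A N) : ℝ :=
  ((if ac τ 0 = a then (1 : ℝ) else 0) / π s a) * td r γ V s τ 0
    + ∑ k ∈ Ico 1 N, γ ^ k * (pkA π P s N k a (st s τ k) / π s a) * td r γ V s τ k

/-- `V` satisfies the Bellman equation for `π`:
`V(s₀) = Σ_a π(a|s₀)·(r(s₀,a) + γ·Σ_{s'} P(s'|s₀,a)·V(s'))` for every state `s₀`. -/
def IsBellman (π : S → A → ℝ) (P : S → A → S → ℝ) (r : S → A → ℝ) (γ : ℝ)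
    (V : S → ℝ) : Prop :=
  ∀ s₀ : S, V s₀ = ∑ a : A, π s₀ a * (r s₀ a + γ * ∑ s' : S, P s₀ a s' * V s')

/-- The conditional second moment `E_π[δ_k² | S_0 = s, S_k = s']`,
defined as `(Σ_{τ : S_k = s'} P_π(τ)·δ_k(τ)²)/p_k(s'|s)`. -/
noncomputable def sndMom (π : S → A → ℝ) (P : S → A → S → ℝ) (r : S → A → ℝ)
    (γ : ℝ) (V : S → ℝ) (s : S) (N k : ℕ) (s' : S) : ℝ :=
  (∑ τ : Traj S A N, if st s τ k = s' then trajP π P s N τ * (td r γ V s τ k) ^ 2 else 0)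
    / pkS π P s N k s'

/-- Extend a trajectory by one step. -/
def ext1 {S A : Type*} {N : ℕ} (τ : Traj S A N) (a : A) (x : S) : Traj S A (N + 1) :=
  (Fin.snoc (α := fun _ => A) τ.1 a, Fin.snoc (α := fun _ => S) τ.2 x)

theorem st_ext1 {S A : Type*} {N : ℕ} (s : S) (τ : Traj S A N) (a : A) (x : S) (k : ℕ)
    (hk : k ≤ N) : st s (ext1 τ a x) k = st s τ k := by
  cases k with
  | zero => rfl
  | succ k =>
    have h1 : k < N := hk
    have h2 : k < N + 1 := by omega
    simp [st, ext1, h1, h2, Fin.snoc]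

theorem st_ext1_last {S A : Type*} {N : ℕ} (s : S) (τ : Traj S A N) (a : A) (x : S) :
    st s (ext1 τ a x) (N + 1) = x := by
  simp [st, ext1, Fin.snoc]

theorem ac_ext1 {S A : Type*} [Nonempty A] {N : ℕ} (τ : Traj S A N) (a : A) (x : S) (k : ℕ)
    (hk : k < N) : ac (ext1 τ a x) k = ac τ k := by
  have h2 : k < N + 1 := by omega
  simp [ac, ext1, hk, h2, Fin.snoc]

theorem ac_ext1_last {S A : Type*} [Nonempty A] {N : ℕ} (τ : Traj S A N) (a : A) (x : S) :
    ac (ext1 τ a x) N = a := by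
  simp [ac, ext1, Fin.snoc]

theorem trajP_ext1 {S A : Type*} [Fintype S] [Fintype A] [Nonempty S] [Nonempty A]
    (π : S → A → ℝ) (P : S → A → S → ℝ) (s : S) (N : ℕ) (τ : Traj S A N) (a : A) (x : S) :
    trajP π P s (N + 1) (ext1 τ a x)
      = trajP π P s N τ * (π (st s τ N) a * P (st s τ N) a x) := by
  unfold trajP
  rw [Fin.prod_univ_castSucc]
  congr 1
  · refine Finset.prod_congr rfl fun k _ => ?_
    have h1 : (ext1 τ a x).1 k.castSucc = τ.1 k := by simp [ext1]
    rw [h1, Fin.val_castSucc, st_ext1 s τ a x k (by omega), st_ext1 s τ a x (k + 1) (by omega)]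
  · have h1 : (ext1 τ a x).1 (Fin.last N) = a := by simp [ext1]
    rw [h1, Fin.val_last, st_ext1 s τ a x N le_rfl, st_ext1_last]

theorem expct_succ {S A : Type*} [Fintype S] [Fintype A] [Nonempty S] [Nonempty A]
    (π : S → A → ℝ) (P : S → A → S → ℝ) (s : S) (N : ℕ) (f : Traj S A (N + 1) → ℝ) :
    expct π P s (N + 1) f = expct π P s N (fun τ =>
      ∑ a : A, π (st s τ N) a * ∑ x : S, P (st s τ N) a x * f (ext1 τ a x)) := by
  unfold expct
  have e : Function.Bijective
      (fun p : Traj S A N × (A × S) => ext1 p.1 p.2.1 p.2.2) := by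
    constructor
    · rintro ⟨⟨u, v⟩, a, x⟩ ⟨⟨u', v'⟩, a', x'⟩ h
      simp only [ext1, Prod.mk.injEq, Fin.snoc_inj] at h
      obtain ⟨⟨rfl, rfl⟩, rfl, rfl⟩ := h
      rfl
    · rintro ⟨u, v⟩
      refine ⟨((Fin.init u, Fin.init v), (u (Fin.last N), v (Fin.last N))), ?_⟩
      simp [ext1]
  rw [← e.sum_comp (fun τ => trajP π P s (N + 1) τ * f τ), Fintype.sum_prod_type]
  refine Finset.sum_congr rfl fun τ _ => ?_
  rw [Fintype.sum_prod_type, Finset.mul_sum]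
  refine Finset.sum_congr rfl fun a _ => ?_
  rw [Finset.mul_sum, Finset.mul_sum]
  refine Finset.sum_congr rfl fun x _ => ?_
  simp only [trajP_ext1]
  ring

theorem expct_td {S A : Type*} [Fintype S] [Fintype A] [Nonempty S] [Nonempty A]
    (π : S → A → ℝ) (P : S → A → S → ℝ) (r : S → A → ℝ) (γ : ℝ) (s : S)
    (hπsum : ∀ s₀ : S, ∑ a : A, π s₀ a = 1)
    (hPsum : ∀ (s₀ : S) (a : A), ∑ s' : S, P s₀ a s' = 1)
    (V : S → ℝ) (hV : IsBellman π P r γ V) (t : ℕ) :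
    ∀ (N : ℕ), t < N → ∀ c : Traj S A N → ℝ,
    (∀ τ τ' : Traj S A N, (∀ k < t, ac τ k = ac τ' k) →
      (∀ k ≤ t, st s τ k = st s τ' k) → c τ = c τ') →
    expct π P s N (fun τ => c τ * td r γ V s τ t) = 0 := by
  intro N
  induction N with
  | zero => intro h; omega
  | succ N ih =>
    intro htN c hc
    have a₀ : A := Classical.arbitrary A
    have x₀ : S := Classical.arbitrary S
    have hcc : ∀ τ a x, c (ext1 τ a x) = c (ext1 τ a₀ x₀) := by
      intro τ a x
      apply hc
      · intro k hk
        rw [ac_ext1 _ _ _ _ (by omega), ac_ext1 _ _ _ _ (by omega)]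
      · intro k hk
        rw [st_ext1 _ _ _ _ _ (by omega), st_ext1 _ _ _ _ _ (by omega)]
    rw [expct_succ]
    rcases Nat.lt_or_ge t N with h | h
    · rw [← ih h (fun τ => c (ext1 τ a₀ x₀)) ?_]
      · congr 1
        funext τ
        have htd : ∀ a x, td r γ V s (ext1 τ a x) t = td r γ V s τ t := by
          intro a x
          unfold td
          rw [ac_ext1 _ _ _ _ h, st_ext1 _ _ _ _ _ (by omega), st_ext1 _ _ _ _ _ (by omega)]
        simp only [hcc τ, htd, ← Finset.sum_mul, hPsum, hπsum, one_mul]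
      · intro τ τ' h1 h2
        apply hc
        · intro k hk
          rw [ac_ext1 _ _ _ _ (by omega), ac_ext1 _ _ _ _ (by omega)]
          exact h1 k hk
        · intro k hk
          rw [st_ext1 _ _ _ _ _ (by omega), st_ext1 _ _ _ _ _ (by omega)]
          exact h2 k hk
    · obtain rfl : t = N := by omega
      unfold expct
      refine Finset.sum_eq_zero fun τ _ => ?_
      have htd : ∀ a x, td r γ V s (ext1 τ a x) t
          = r (st s τ t) a + γ * V x - V (st s τ t) := by
        intro a x
        unfold td
        rw [ac_ext1_last, st_ext1_last, st_ext1 _ _ _ _ _ le_rfl]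
      simp only [hcc τ, htd]
      generalize st s τ t = y
      generalize c (ext1 τ a₀ x₀) = C
      have h1 : ∀ a, ∑ x, P y a x * (C * (r y a + γ * V x - V y))
          = C * ((r y a + γ * ∑ x, P y a x * V x) - V y) := by
        intro a
        have h2 : ∀ x, P y a x * (C * (r y a + γ * V x - V y))
            = P y a x * (C * (r y a - V y)) + C * γ * (P y a x * V x) := by
          intro x; ring
        simp only [h2, Finset.sum_add_distrib, ← Finset.sum_mul, ← Finset.mul_sum, hPsum]
        ring
      have h3 : ∑ a, π y a * ∑ x, P y a x * (C * (r y a + γ * V x - V y)) = 0 := by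
        have h4 : ∀ a, π y a * ∑ x, P y a x * (C * (r y a + γ * V x - V y))
            = C * (π y a * (r y a + γ * ∑ x, P y a x * V x)) - π y a * (C * V y) := by
          intro a; rw [h1]; ring
        rw [Finset.sum_congr rfl fun a _ => h4 a, Finset.sum_sub_distrib, ← Finset.mul_sum,
          ← Finset.sum_mul, hπsum, ← hV y]
        ring
      rw [h3, mul_zero]

theorem stmt_2 {S A : Type*} [Fintype S] [Fintype A] [Nonempty S] [Nonempty A]
    (π : S → A → ℝ) (P : S → A → S → ℝ) (r : S → A → ℝ) (γ : ℝ)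
    (N : ℕ) (s : S)
    (hπpos : ∀ s₀ a, 0 < π s₀ a) (hπsum : ∀ s₀ : S, ∑ a : A, π s₀ a = 1)
    (hPnn : ∀ s₀ a s', 0 ≤ P s₀ a s') (hPsum : ∀ (s₀ : S) (a : A), ∑ s' : S, P s₀ a s' = 1)
    (hγ0 : 0 ≤ γ) (hγ1 : γ ≤ 1) (hN : 1 ≤ N)
    (V : S → ℝ) (hV : IsBellman π P r γ V)
    (t' t'' : ℕ) (ht : t' ≤ t'') (htN : t'' ≤ N - 1)
    (b' b'' : Traj S A N → ℝ)
    (hb' : ∀ τ τ' : Traj S A N, (∀ k < t', ac τ k = ac τ' k) →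
      (∀ k ≤ t', st s τ k = st s τ' k) → b' τ = b' τ')
    (hb'' : ∀ τ τ' : Traj S A N, (∀ k < t'', ac τ k = ac τ' k) →
      (∀ k ≤ t'', st s τ k = st s τ' k) → b'' τ = b'' τ') :
    cv π P s N b' (fun τ => b'' τ * td r γ V s τ t'') = 0 := by
  have h0 : expct π P s N (fun τ => b'' τ * td r γ V s τ t'') = 0 :=
    expct_td π P r γ s hπsum hPsum V hV t'' N (by omega) b'' hb''
  unfold cv
  rw [h0]
  have h1 := expct_td π P r γ s hπsum hPsum V hV t'' N (by omega)
    (fun τ => (b' τ - expct π P s N b') * b'' τ) (by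
      intro τ τ' ha hs
      have e1 := hb' τ τ' (fun k hk => ha k (by omega)) (fun k hk => hs k (by omega))
      have e2 := hb'' τ τ' ha hs
      simp only [e1, e2])
  refine Eq.trans ?_ h1
  congr 1
  funext τ
  ring

end HCA
end

section
/- Suppose V̂ satisfies the Bellman equation for π. Then for every action a, the conditional variance of the Monte-Carlo estimator decomposes as a sum of per-step variances with no cross terms: Var_π(Â^MC_N(a) | S_0 = s) = Σ_{k=0}^{N−1} γ^{2k}·Var_π((1(A_0=a)/π(a|s))·δ_k | S_0 = s). -/
open Finset

attribute [local instance] Classical.propDecidable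

namespace HCA

variable {S A : Type*} [Fintype S] [Fintype A] [Nonempty S] [Nonempty A]

lemma sum_cons (N : ℕ) (F : Traj S A (N + 1) → ℝ) :
    ∑ τ, F τ = ∑ a : A, ∑ s' : S, ∑ τ : Traj S A N,
      F ((Fin.cons a τ.1 : Fin (N + 1) → A), (Fin.cons s' τ.2 : Fin (N + 1) → S)) := by
  have h1 : ∀ (B : Type _) [Fintype B] (G : (Fin (N + 1) → B) → ℝ),
      ∑ x, G x = ∑ b : B, ∑ y : Fin N → B, G (Fin.cons b y) := by
    intro B _ G
    rw [← (Fin.consEquiv (fun _ : Fin (N + 1) => B)).sum_comp, Fintype.sum_prod_type]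
    rfl
  have h2 : ∀ (B : Type _) [Fintype B] (G : (Fin (N + 1) → B) → ℝ),
      ∑ x, G x = ∑ b : B, ∑ y : Fin N → B, G (Fin.cons b y) := by
    intro B _ G
    rw [← (Fin.consEquiv (fun _ : Fin (N + 1) => B)).sum_comp, Fintype.sum_prod_type]
    rfl
  rw [Fintype.sum_prod_type, h1]
  refine Finset.sum_congr rfl fun a _ => ?_
  rw [Finset.sum_congr rfl fun y _ => h2 S (fun x => F (Fin.cons a y, x))]
  rw [Finset.sum_comm]
  refine Finset.sum_congr rfl fun s' _ => ?_
  rw [Fintype.sum_prod_type]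

lemma st_cons {N : ℕ} (s s' : S) (a : A) (τ : Traj S A N) (k : ℕ) (hk : k ≤ N) :
    st s (((Fin.cons a τ.1 : Fin (N + 1) → A), (Fin.cons s' τ.2 : Fin (N + 1) → S)) :
      Traj S A (N + 1)) (k + 1) = st s' τ k := by
  cases k with
  | zero => simp [st]
  | succ j =>
    have h1 : j < N := hk
    have h2 : j + 1 < N + 1 := Nat.succ_lt_succ h1
    simp only [st, dif_pos h1, dif_pos h2]
    rfl

lemma ac_cons {N : ℕ} (s' : S) (a : A) (τ : Traj S A N) (k : ℕ) (hk : k < N) :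
    ac (((Fin.cons a τ.1 : Fin (N + 1) → A), (Fin.cons s' τ.2 : Fin (N + 1) → S)) :
      Traj S A (N + 1)) (k + 1) = ac τ k := by
  have h2 : k + 1 < N + 1 := Nat.succ_lt_succ hk
  simp only [ac, dif_pos hk, dif_pos h2]
  rfl

lemma trajP_cons {N : ℕ} (π : S → A → ℝ) (P : S → A → S → ℝ)
    (s s' : S) (a : A) (τ : Traj S A N) :
    trajP π P s (N + 1) ((Fin.cons a τ.1 : Fin (N + 1) → A), (Fin.cons s' τ.2 : Fin (N + 1) → S))
      = π s a * P s a s' * trajP π P s' N τ := by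
  unfold trajP
  rw [Fin.prod_univ_succ]
  congr 1
  refine Finset.prod_congr rfl fun k _ => ?_
  have h1 := st_cons s s' a τ k k.2.le
  have h2 := st_cons s s' a τ (k + 1) k.2
  simp only [Fin.val_succ, Fin.cons_succ]
  rw [h1, h2]

lemma expct_cons (π : S → A → ℝ) (P : S → A → S → ℝ) (s : S) (N : ℕ)
    (f : Traj S A (N + 1) → ℝ) :
    expct π P s (N + 1) f = ∑ a : A, ∑ s' : S, π s a * P s a s' *
      expct π P s' N (fun τ =>
        f ((Fin.cons a τ.1 : Fin (N + 1) → A), (Fin.cons s' τ.2 : Fin (N + 1) → S))) := by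
  unfold expct
  rw [sum_cons]
  simp_rw [trajP_cons, Finset.mul_sum, mul_assoc]

lemma expct_const (π : S → A → ℝ) (P : S → A → S → ℝ)
    (hπsum : ∀ s₀ : S, ∑ a : A, π s₀ a = 1)
    (hPsum : ∀ (s₀ : S) (a : A), ∑ s' : S, P s₀ a s' = 1) (N : ℕ) :
    ∀ (s : S) (c : ℝ), expct π P s N (fun _ => c) = c := by
  induction N with
  | zero => intro s c; simp [expct, trajP]
  | succ N ih =>
    intro s c
    rw [expct_cons]
    simp_rw [ih, ← Finset.sum_mul, ← Finset.mul_sum, hPsum, mul_one, hπsum, one_mul]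

/-- A function of the history before step `k` is uncorrelated with the TD error at step `k`. -/
lemma expct_mul_td (π : S → A → ℝ) (P : S → A → S → ℝ) (r : S → A → ℝ) (γ : ℝ)
    (hπsum : ∀ s₀ : S, ∑ a : A, π s₀ a = 1)
    (hPsum : ∀ (s₀ : S) (a : A), ∑ s' : S, P s₀ a s' = 1)
    (V : S → ℝ) (hV : IsBellman π P r γ V) (N : ℕ) :
    ∀ (s : S) (k : ℕ) (_ : k < N) (g : Traj S A N → ℝ)
      (_ : ∀ τ τ' : Traj S A N,
        (∀ i : Fin N, (i : ℕ) < k → τ.1 i = τ'.1 i ∧ τ.2 i = τ'.2 i) → g τ = g τ'),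
      expct π P s N (fun τ => g τ * td r γ V s τ k) = 0 := by
  induction N with
  | zero => intro s k hk; omega
  | succ N ih =>
    intro s k hk g hg
    rw [expct_cons]
    cases k with
    | zero =>
      obtain ⟨c, hc⟩ : ∃ c, ∀ τ, g τ = c :=
        ⟨g (fun _ => Classical.arbitrary A, fun _ => s), fun τ => hg _ _ (by simp)⟩
      have h : ∀ (a : A) (s' : S) (τ : Traj S A N),
          td r γ V s (((Fin.cons a τ.1 : Fin (N + 1) → A), (Fin.cons s' τ.2 : Fin (N + 1) → S)) :
            Traj S A (N + 1)) 0 = r s a + γ * V s' - V s := by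
        intro a s' τ
        simp [td, st, ac]
      simp_rw [hc, h, expct_const π P hπsum hPsum]
      have h3 : ∀ a : A, ∑ s' : S, π s a * P s a s' * (c * (r s a + γ * V s' - V s))
          = c * (π s a * (r s a + γ * ∑ s' : S, P s a s' * V s')) - c * V s * π s a := by
        intro a
        have : ∀ s' : S, π s a * P s a s' * (c * (r s a + γ * V s' - V s))
          = c * π s a * (r s a - V s) * P s a s' + c * π s a * γ * (P s a s' * V s') := by
          intro s'; ring
        simp_rw [this, Finset.sum_add_distrib, ← Finset.mul_sum, hPsum]
        ring
      simp_rw [h3, Finset.sum_sub_distrib, ← Finset.mul_sum, hπsum, ← hV s]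
      ring
    | succ k =>
      have hk' : k < N := by omega
      refine Finset.sum_eq_zero fun a _ => Finset.sum_eq_zero fun s' _ => ?_
      have h : ∀ τ : Traj S A N,
          td r γ V s (((Fin.cons a τ.1 : Fin (N + 1) → A), (Fin.cons s' τ.2 : Fin (N + 1) → S)) :
            Traj S A (N + 1)) (k + 1) = td r γ V s' τ k := by
        intro τ
        unfold td
        rw [st_cons s s' a τ k hk'.le, st_cons s s' a τ (k + 1) hk', ac_cons s' a τ k hk']
      simp_rw [h]
      rw [ih s' k hk' (fun τ => g ((Fin.cons a τ.1 : Fin (N + 1) → A),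
        (Fin.cons s' τ.2 : Fin (N + 1) → S))), mul_zero]
      intro τ τ' hh
      apply hg
      intro i
      refine Fin.cases ?_ (fun j => ?_) i
      · simp
      · intro hj
        simpa using hh j (by simpa using hj)

lemma expct_sum (π : S → A → ℝ) (P : S → A → S → ℝ) (s : S) (N : ℕ) {ι : Type*}
    (t : Finset ι) (c : ι → ℝ) (f : ι → Traj S A N → ℝ) :
    expct π P s N (fun τ => ∑ k ∈ t, c k * f k τ) = ∑ k ∈ t, c k * expct π P s N (f k) := by
  unfold expct
  simp_rw [Finset.mul_sum]
  rw [Finset.sum_comm]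
  refine Finset.sum_congr rfl fun k _ => Finset.sum_congr rfl fun τ _ => by ring

lemma st_congr {N : ℕ} (s : S) (τ τ' : Traj S A N) (k j : ℕ) (hj : j ≤ k)
    (h : ∀ i : Fin N, (i : ℕ) < k → τ.1 i = τ'.1 i ∧ τ.2 i = τ'.2 i) :
    st s τ j = st s τ' j := by
  cases j with
  | zero => rfl
  | succ j =>
    simp only [st]
    split_ifs with h1
    · exact (h ⟨j, h1⟩ hj).2
    · rfl

lemma ac_congr {N : ℕ} (τ τ' : Traj S A N) (k j : ℕ) (hj : j < k)
    (h : ∀ i : Fin N, (i : ℕ) < k → τ.1 i = τ'.1 i ∧ τ.2 i = τ'.2 i) :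
    ac τ j = ac τ' j := by
  unfold ac
  split_ifs with h1
  · exact (h ⟨j, h1⟩ hj).1
  · rfl

theorem stmt_6 {S A : Type*} [Fintype S] [Fintype A] [Nonempty S] [Nonempty A]
    (π : S → A → ℝ) (P : S → A → S → ℝ) (r : S → A → ℝ) (γ : ℝ)
    (N : ℕ) (s : S)
    (hπpos : ∀ s₀ a, 0 < π s₀ a) (hπsum : ∀ s₀ : S, ∑ a : A, π s₀ a = 1)
    (hPnn : ∀ s₀ a s', 0 ≤ P s₀ a s') (hPsum : ∀ (s₀ : S) (a : A), ∑ s' : S, P s₀ a s' = 1)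
    (hγ0 : 0 ≤ γ) (hγ1 : γ ≤ 1) (hN : 1 ≤ N)
    (V : S → ℝ) (hV : IsBellman π P r γ V) :
    ∀ a : A, vr π P s N (mcEst π r γ V s N a)
      = ∑ k ∈ range N, γ ^ (2 * k) *
          vr π P s N (fun τ => (if ac τ 0 = a then (1 : ℝ) else 0) / π s a * td r γ V s τ k) := by
  intro a
  set X : ℕ → Traj S A N → ℝ := fun k τ =>
    (if ac τ 0 = a then (1 : ℝ) else 0) / π s a * td r γ V s τ k with hX
  have hmc : mcEst π r γ V s N a = fun τ => ∑ k ∈ range N, γ ^ k * X k τ := by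
    funext τ
    simp only [mcEst, hX, Finset.mul_sum]
    exact Finset.sum_congr rfl fun k _ => by ring
  have hX0 : ∀ k, 0 < k → k < N → expct π P s N (X k) = 0 := by
    intro k hk hkN
    refine expct_mul_td π P r γ hπsum hPsum V hV N s k hkN
      (fun τ => (if ac τ 0 = a then (1 : ℝ) else 0) / π s a) ?_
    intro τ τ' h
    simp only [ac_congr τ τ' k 0 hk h]
  have hlt : ∀ j k, j < k → k < N → expct π P s N
      (fun τ => (X j τ - expct π P s N (X j)) * (X k τ - expct π P s N (X k))) = 0 := by
    intro j k hjk hkN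
    rw [hX0 k (by omega) hkN]
    have := expct_mul_td π P r γ hπsum hPsum V hV N s k hkN
      (fun τ => (X j τ - expct π P s N (X j)) *
        ((if ac τ 0 = a then (1 : ℝ) else 0) / π s a)) (by
        intro τ τ' h
        simp only [hX, td, ac_congr τ τ' k 0 (by omega) h, ac_congr τ τ' k j hjk h,
          st_congr s τ τ' k j hjk.le h, st_congr s τ τ' k (j + 1) hjk h])
    refine Eq.trans ?_ this
    congr 1
    funext τ
    have hk : X k τ = (if ac τ 0 = a then (1 : ℝ) else 0) / π s a * td r γ V s τ k := rfl
    rw [hk]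
    ring
  have hne : ∀ j k, j < N → k < N → j ≠ k → expct π P s N
      (fun τ => (X j τ - expct π P s N (X j)) * (X k τ - expct π P s N (X k))) = 0 := by
    intro j k hj hk hjk
    rcases lt_or_gt_of_ne hjk with h | h
    · exact hlt j k h hk
    · rw [← hlt k j h hj]
      congr 1
      funext τ
      ring
  change _ = ∑ k ∈ range N, γ ^ (2 * k) * vr π P s N (X k)
  rw [hmc]
  unfold vr
  rw [expct_sum]
  have hsq : (fun τ => (∑ k ∈ range N, γ ^ k * X k τ
        - ∑ k ∈ range N, γ ^ k * expct π P s N (X k)) ^ 2)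
      = fun τ => ∑ j ∈ range N, γ ^ j * (∑ k ∈ range N, γ ^ k *
        ((X j τ - expct π P s N (X j)) * (X k τ - expct π P s N (X k)))) := by
    funext τ
    rw [← Finset.sum_sub_distrib, sq, Finset.sum_mul_sum]
    refine Finset.sum_congr rfl fun j _ => ?_
    rw [Finset.mul_sum]
    exact Finset.sum_congr rfl fun k _ => by ring
  rw [hsq, expct_sum]
  refine Finset.sum_congr rfl fun j hj => ?_
  rw [expct_sum, Finset.sum_eq_single_of_mem j hj]
  · rw [← mul_assoc, ← pow_add, two_mul]
    congr 2
    funext τ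
    ring
  · intro k hk hkj
    rw [hne j k (mem_range.1 hj) (mem_range.1 hk) hkj.symm, mul_zero]

end HCA
end
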